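/- arXiv:2505.19648 — 2 statements merged into one kernel-verified Lean document; each statement's English description precedes it below -/
import Mathlib

section
/- Let Γ be an SNF sentence over L with m existentially quantified conjuncts, and set δ = max(m(m+1), 2m+1). For every configuration n and every 1-type τ with n(τ) > δ: if n is satisfiable with respect to Γ, then the configuration n[τ ↦ δ], which equals n at every 1-type except that its value at τ is δ, is satisfiable with respect to Γ. -/
/-- An `L`-structure (for a language `L` with unary symbols `U` and binary
symbols `B`) on domain `D`. -/
structure Struc (U B : Type) (D : Type) where
  unary : U → D → Prop
  binary : B → D → D → Prop

/-- Quantifier-free formulas over relational atoms in the two variables `x`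
(encoded as `false`) and `y` (encoded as `true`), built using `¬`, `∧`, `∨`
only (no equality). -/
inductive QF (U B : Type) where
  | uatom : U → Bool → QF U B
  | batom : B → Bool → Bool → QF U B
  | not : QF U B → QF U B
  | and : QF U B → QF U B → QF U B
  | or : QF U B → QF U B → QF U B

/-- Evaluation of a quantifier-free formula in a structure with `x ↦ a`, `y ↦ b`. -/
def QF.Eval {U B D : Type} (S : Struc U B D) (a b : D) : QF U B → Prop
  | .uatom P v => S.unary P (if v then b else a)
  | .batom R v w => S.binary R (if v then b else a) (if w then b else a)
  | .not f => ¬ f.Eval S a b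
  | .and f g => f.Eval S a b ∧ g.Eval S a b
  | .or f g => f.Eval S a b ∨ g.Eval S a b

/-- An SNF sentence `(∀x∀y φ(x,y)) ∧ ⋀_{k=1}^m (∀x∃y β_k(x,y))`. -/
structure SNF (U B : Type) where
  m : ℕ
  phi : QF U B
  beta : Fin m → B

/-- Satisfaction of an SNF sentence in a structure. -/
def SNF.Sat {U B D : Type} (Γ : SNF U B) (S : Struc U B D) : Prop :=
  (∀ a b, Γ.phi.Eval S a b) ∧ ∀ k a, ∃ b, S.binary (Γ.beta k) a b

/-- A 1-type: a truth-value assignment to each atomic formula `P(x)`, `R(x,x)`. -/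
structure OneType (U B : Type) where
  unary : U → Prop
  binary : B → Prop

/-- An element `e` realizes a 1-type `τ` in a structure `S`. -/
def Realizes1 {U B D : Type} (S : Struc U B D) (e : D) (τ : OneType U B) : Prop :=
  (∀ P, S.unary P e ↔ τ.unary P) ∧ (∀ R, S.binary R e e ↔ τ.binary R)

/-- The configuration of a structure: the number of elements realizing each 1-type. -/
noncomputable def config {U B D : Type} (S : Struc U B D) : OneType U B → ℕ :=
  fun τ => Nat.card {e : D // Realizes1 S e τ}

/-- A configuration `n` is satisfiable w.r.t. `Γ`: some finite model of `Γ` has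
configuration `n`. -/
def SatConfig {U B : Type} (Γ : SNF U B) (n : OneType U B → ℕ) : Prop :=
  ∃ (D : Type) (_ : Fintype D) (M : Struc U B D), Γ.Sat M ∧ config M = n

/-- The derivation relation `n ≼ n'` on configurations. -/
def Derives {U B : Type} (n n' : OneType U B → ℕ) : Prop :=
  ∀ τ, (0 < n τ → n τ ≤ n' τ) ∧ (n τ = 0 → n' τ = n τ)

/-- The structure on `E` in which the pair `x, y` looks like the pair `r x y, r y x` of `M`. -/
def Struc.glue {U B D E : Type} (M : Struc U B D) (r : E → E → D) : Struc U B E where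
  unary P x := M.unary P (r x x)
  binary R x y := M.binary R (r x y) (r y x)

theorem Realizes1.unique {U B D : Type} {M : Struc U B D} {e : D} {σ τ : OneType U B}
    (h₁ : Realizes1 M e σ) (h₂ : Realizes1 M e τ) : σ = τ := by
  obtain ⟨σu, σb⟩ := σ
  obtain ⟨τu, τb⟩ := τ
  congr
  · funext P
    exact propext ((h₁.1 P).symm.trans (h₂.1 P))
  · funext R
    exact propext ((h₁.2 R).symm.trans (h₂.2 R))

/-- Gluing preserves the truth of quantifier-free formulas, provided that the representatives of
each element all have the same 1-type. -/
theorem Struc.glue_eval_iff {U B D E : Type} (M : Struc U B D) (r : E → E → D)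
    (hr : ∀ x y, ∃ σ, Realizes1 M (r x x) σ ∧ Realizes1 M (r x y) σ) (φ : QF U B) (x y : E) :
    φ.Eval (M.glue r) x y ↔ φ.Eval M (r x y) (r y x) := by
  obtain ⟨σ, h₁, h₂⟩ := hr x y
  obtain ⟨ρ, h₃, h₄⟩ := hr y x
  induction φ with
  | uatom P v =>
    cases v
    · exact (h₁.1 P).trans (h₂.1 P).symm
    · exact (h₃.1 P).trans (h₄.1 P).symm
  | batom R v w =>
    cases v <;> cases w
    · exact (h₁.2 R).trans (h₂.2 R).symm
    · exact Iff.rfl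
    · exact Iff.rfl
    · exact (h₃.2 R).trans (h₄.2 R).symm
  | not f ih => exact not_congr ih
  | and f g ihf ihg => exact and_congr ihf ihg
  | or f g ihf ihg => exact or_congr ihf ihg

/-- Internal witnesses on a cyclically ordered set: if `m` binary relations are each either
arbitrary or realized on a pair `(p k, q k)` from `A`, the pairs of a set with at least `2 * m + 1`
elements can be assigned representatives in `A` so that each element sees every `(p k, q k)`. -/
theorem exists_cyclic_representatives {D : Type} (m N : ℕ) (hN : 2 * m + 1 ≤ N) (A : D → Prop)
    (a₀ : D) (ha₀ : A a₀) (p q : Fin m → D) (hp : ∀ k, A (p k)) (hq : ∀ k, A (q k)) :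
    ∃ r : Fin N → Fin N → D, (∀ i j, A (r i j)) ∧
      ∀ k i, ∃ j, r i j = p k ∧ r j i = q k := by
  classical
  let dist : Fin N → Fin N → ℕ := fun i j => (j.val + N - i.val) % N
  refine ⟨fun i j => if h : 1 ≤ dist i j ∧ dist i j ≤ m then p ⟨dist i j - 1, by omega⟩
    else if h : 1 ≤ dist j i ∧ dist j i ≤ m then q ⟨dist j i - 1, by omega⟩ else a₀, ?_, ?_⟩
  · intro i j
    dsimp only
    split_ifs
    exacts [hp _, hq _, ha₀]
  · intro k i
    have hk := k.isLt
    have hi := i.isLt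
    let j : Fin N := ⟨(i.val + k.val + 1) % N, Nat.mod_lt _ (by omega)⟩
    have hjval : j.val = i.val + k.val + 1 ∨ j.val + N = i.val + k.val + 1 := by
      by_cases h : i.val + k.val + 1 < N
      · exact Or.inl (Nat.mod_eq_of_lt h)
      · right
        change (i.val + k.val + 1) % N + N = _
        rw [Nat.mod_eq_sub_mod (by omega), Nat.mod_eq_of_lt (by omega)]
        omega
    have hjlt := j.isLt
    have hij : dist i j = k.val + 1 := by
      change (j.val + N - i.val) % N = _
      rcases hjval with h | h
      · rw [show j.val + N - i.val = (k.val + 1) + N by omega, Nat.add_mod_right,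
          Nat.mod_eq_of_lt (by omega)]
      · rw [show j.val + N - i.val = k.val + 1 by omega, Nat.mod_eq_of_lt (by omega)]
    have hji : dist j i = N - (k.val + 1) := by
      change (i.val + N - j.val) % N = _
      rcases hjval with h | h
      · rw [show i.val + N - j.val = N - (k.val + 1) by omega, Nat.mod_eq_of_lt (by omega)]
      · rw [show i.val + N - j.val = (N - (k.val + 1)) + N by omega, Nat.add_mod_right,
          Nat.mod_eq_of_lt (by omega)]
    refine ⟨j, ?_, ?_⟩
    · dsimp only
      rw [dif_pos (by omega)]
      congr 1
      ext
      simp [hij]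
    · dsimp only
      rw [dif_neg (by omega), dif_pos (by omega)]
      congr 1
      ext
      simp [hij]

/-- Given witness functions `w k` on `D`, a set with at least `m * (m + 1)` elements can be
assigned representatives in `A`, depending on the element `c` outside `A` that looks at them, such
that all witnesses in `A` of elements outside `A` are represented, and each element of the set has,
for each `k`, either a witness outside `A` or a representative whose witness lies in `A`. -/
theorem exists_outer_representatives {D : Type} (m N : ℕ) (hN : m * (m + 1) ≤ N) (A : D → Prop)
    (a₀ : D) (ha₀ : A a₀) (w : Fin m → D → D) :
    ∃ f : D → Fin N → D, (∀ c i, A (f c i)) ∧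
      (∀ k c, A (w k c) → ∃ i, f c i = w k c) ∧
      ∀ k i, ∃ a, A a ∧ (¬ A (w k a) → f (w k a) i = a) := by
  classical
  obtain ⟨code⟩ : Nonempty (Option (Fin m) × Fin m ↪ Fin N) := by
    apply Function.Embedding.nonempty_of_card_le
    simpa [mul_comm] using hN
  let dec : Fin N → Option (Option (Fin m) × Fin m) := Function.partialInv code
  have hdec : ∀ s, dec (code s) = some s := Function.partialInv_left code.injective
  let g : D → Option (Option (Fin m) × Fin m) → D := fun c o =>
    match o with
    | none => a₀
    | some (none, i) => if (∀ l, c ≠ w l a₀) ∧ A (w i c) then w i c else a₀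
    | some (some l, i) => if A (w i (w l a₀)) then w i (w l a₀) else a₀
  have hg : ∀ c o, A (g c o) := by
    rintro c (_ | ⟨_ | l, i⟩)
    · exact ha₀
    · dsimp only [g]
      split_ifs with h
      exacts [h.2, ha₀]
    · dsimp only [g]
      split_ifs with h
      exacts [h, ha₀]
  refine ⟨fun c i => g c (dec i), fun c i => hg c _, ?_, ?_⟩
  · intro k c hA
    by_cases hc : ∃ l, c = w l a₀
    · obtain ⟨l, rfl⟩ := hc
      refine ⟨code (some l, k), ?_⟩
      simp only [hdec, g]
      exact if_pos hA
    · push Not at hc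
      refine ⟨code (none, k), ?_⟩
      simp only [hdec, g]
      exact if_pos ⟨hc, hA⟩
  · intro k i
    rcases hi : dec i with _ | ⟨_ | l, j⟩
    · exact ⟨a₀, ha₀, fun _ => by simp only [hi, g]⟩
    · refine ⟨a₀, ha₀, fun _ => ?_⟩
      simp only [hi, g]
      exact if_neg fun h => h.1 k rfl
    · exact ⟨g a₀ (some (some l, j)), hg a₀ (some (some l, j)), fun _ => by simp only [hi, g]⟩

open Classical in
/-- The number of elements realizing an occurring 1-type `τ` in a finite model of `Γ` can be set to
any `N ≥ max (m(m+1)) (2m+1)`. -/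
theorem SatConfig.update {U B : Type} {Γ : SNF U B} {n : OneType U B → ℕ} (hn : SatConfig Γ n)
    {τ : OneType U B} (hτ : 0 < n τ) {N : ℕ} (hN₁ : Γ.m * (Γ.m + 1) ≤ N)
    (hN₂ : 2 * Γ.m + 1 ≤ N) : SatConfig Γ (fun σ => if σ = τ then N else n σ) := by
  obtain ⟨D, _, M, ⟨hφ, hβ⟩, rfl⟩ := hn
  choose w hw using hβ
  let A : D → Prop := fun e => Realizes1 M e τ
  obtain ⟨⟨a₀, ha₀⟩⟩ : Nonempty {e : D // A e} := (Nat.card_pos_iff.mp hτ).1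
  have hPair : ∀ k, ∃ p q, A p ∧ A q ∧
      ((∃ a b, A a ∧ A b ∧ M.binary (Γ.beta k) a b) → M.binary (Γ.beta k) p q) := by
    intro k
    by_cases h : ∃ a b, A a ∧ A b ∧ M.binary (Γ.beta k) a b
    · obtain ⟨a, b, ha, hb, hab⟩ := h
      exact ⟨a, b, ha, hb, fun _ => hab⟩
    · exact ⟨a₀, a₀, ha₀, ha₀, fun h' => absurd h' h⟩
  choose p q hp hq hpq using hPair
  obtain ⟨s, hsA, hs⟩ := exists_cyclic_representatives Γ.m N hN₂ A a₀ ha₀ p q hp hq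
  obtain ⟨f, hfA, hfC, hf⟩ := exists_outer_representatives Γ.m N hN₁ A a₀ ha₀ w
  let r : {e : D // ¬ A e} ⊕ Fin N → {e : D // ¬ A e} ⊕ Fin N → D := fun x y =>
    match x, y with
    | .inl c, _ => c
    | .inr i, .inl c => f c i
    | .inr i, .inr j => s i j
  have hr : ∀ x y, ∃ σ, Realizes1 M (r x x) σ ∧ Realizes1 M (r x y) σ := by
    rintro (c | i) y
    · exact ⟨⟨fun P => M.unary P c, fun R => M.binary R c c⟩,
        ⟨fun _ => Iff.rfl, fun _ => Iff.rfl⟩, ⟨fun _ => Iff.rfl, fun _ => Iff.rfl⟩⟩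
    · refine ⟨τ, hsA i i, ?_⟩
      rcases y with c | j
      exacts [hfA _ _, hsA _ _]
  refine ⟨{e : D // ¬ A e} ⊕ Fin N, inferInstance, M.glue r, ⟨?_, ?_⟩, ?_⟩
  · exact fun x y => (M.glue_eval_iff r hr _ x y).2 (hφ _ _)
  · rintro k (c | i)
    · by_cases h : A (w k c)
      · obtain ⟨i, hi⟩ := hfC k c h
        refine ⟨.inr i, ?_⟩
        change M.binary _ c.1 (f c i)
        exact hi ▸ hw k c
      · exact ⟨.inl ⟨_, h⟩, hw k c⟩
    · obtain ⟨a, ha, hfa⟩ := hf k i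
      by_cases h : A (w k a)
      · obtain ⟨j, h₁, h₂⟩ := hs k i
        refine ⟨.inr j, ?_⟩
        change M.binary _ (s i j) (s j i)
        rw [h₁, h₂]
        exact hpq k ⟨a, _, ha, h, hw k a⟩
      · refine ⟨.inl ⟨_, h⟩, ?_⟩
        change M.binary _ (f (w k a) i) (w k a)
        rw [hfa h]
        exact hw k a
  · funext σ
    dsimp only [config]
    split_ifs with hσ
    · subst hσ
      refine (Nat.card_congr (Equiv.ofBijective
        (fun i : Fin N => (⟨.inr i, hsA i i⟩ : {x // Realizes1 (M.glue r) x σ}))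
        ⟨?_, ?_⟩)).symm.trans (Nat.card_fin N)
      · intro i j hij
        exact Sum.inr_injective (congrArg Subtype.val hij)
      · rintro ⟨c | i, h⟩
        · exact absurd h c.2
        · exact ⟨i, rfl⟩
    · refine (Nat.card_congr (Equiv.ofBijective
        (fun e : {e : D // Realizes1 M e σ} =>
          (⟨.inl ⟨e.1, fun h => hσ (e.2.unique h)⟩, e.2⟩ :
            {x // Realizes1 (M.glue r) x σ})) ⟨?_, ?_⟩)).symm
      · intro i j hij
        simpa [Subtype.ext_iff] using hij
      · rintro ⟨c | i, h⟩
        · exact ⟨⟨c.1, h⟩, rfl⟩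
        · exact absurd (Realizes1.unique h (hsA i i)) hσ

/- **Statement 2.** With `δ = max (m(m+1)) (2m+1)`, if `n τ > δ` and `n` is
satisfiable w.r.t. `Γ`, then the configuration `n[τ ↦ δ]` is satisfiable. -/
open Classical in
theorem statement2 {U B : Type} [Fintype U] [Fintype B] (Γ : SNF U B)
    (n : OneType U B → ℕ) (τ : OneType U B)
    (hτ : max (Γ.m * (Γ.m + 1)) (2 * Γ.m + 1) < n τ)
    (hn : SatConfig Γ n) :
    SatConfig Γ (fun σ => if σ = τ then max (Γ.m * (Γ.m + 1)) (2 * Γ.m + 1) else n σ) := by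
  exact hn.update (by omega) (le_max_left _ _) (le_max_right _ _)
end

section
/- Let Γ be an SNF sentence over L. If Γ has a model over a finite domain of cardinality p with p ≥ 1, then for every integer q ≥ p, Γ has a model over a finite domain of cardinality q. -/
namespace Struc

/-- The pullback of a structure along a map of domains. -/
def comap {U B D E : Type} (S : Struc U B D) (f : E → D) : Struc U B E where
  unary P e := S.unary P (f e)
  binary R e e' := S.binary R (f e) (f e')

end Struc

/-- Evaluation of an equality-free formula commutes with pullback. -/
theorem QF.eval_comap {U B D E : Type} (S : Struc U B D) (f : E → D) (a b : E) (φ : QF U B) :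
    φ.Eval (S.comap f) a b ↔ φ.Eval S (f a) (f b) := by
  induction φ with
  | uatom P v => cases v <;> rfl
  | batom R v w => cases v <;> cases w <;> rfl
  | not φ ih => exact not_congr ih
  | and φ ψ ih₁ ih₂ => exact and_congr ih₁ ih₂
  | or φ ψ ih₁ ih₂ => exact or_congr ih₁ ih₂

/-- The pullback of a model of an SNF sentence along a surjection is a model. -/
theorem SNF.Sat.comap {U B D E : Type} {Γ : SNF U B} {S : Struc U B D} (h : Γ.Sat S)
    {f : E → D} (hf : Function.Surjective f) : Γ.Sat (S.comap f) := by
  refine ⟨fun a b => (QF.eval_comap S f a b Γ.phi).2 (h.1 _ _), fun k a => ?_⟩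
  obtain ⟨d, hd⟩ := h.2 k (f a)
  obtain ⟨b, rfl⟩ := hf d
  exact ⟨b, hd⟩

/-- If an SNF sentence `Γ` has a model over a finite domain of
cardinality `p ≥ 1`, then for every `q ≥ p` it has a model over a finite domain
of cardinality `q`. -/
theorem statement12 {U B : Type} [Fintype U] [Fintype B] (Γ : SNF U B)
    (p q : ℕ) (hp : 1 ≤ p) (hpq : p ≤ q)
    (h : ∃ (D : Type) (_ : Fintype D) (M : Struc U B D), Nat.card D = p ∧ Γ.Sat M) :
    ∃ (D : Type) (_ : Fintype D) (M : Struc U B D), Nat.card D = q ∧ Γ.Sat M := by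
  obtain ⟨D, _, M, hD, hM⟩ := h
  rw [Nat.card_eq_fintype_card] at hD
  have : Nonempty D := Fintype.card_pos_iff.1 (hD ▸ hp)
  obtain ⟨g⟩ : Nonempty (D ↪ Fin q) :=
    Function.Embedding.nonempty_of_card_le (by simpa [hD] using hpq)
  exact ⟨Fin q, inferInstance, M.comap (Function.invFun g), Nat.card_fin q,
    hM.comap (Function.invFun_surjective g.injective)⟩
end
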